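/- Let Ω be a complex symmetric r×r matrix with positive definite imaginary part. Then the Riemann theta function satisfies the modular-type identity Θ_{0,0}(Ω^{−1}z | −Ω^{−1}) = √(det(−iΩ)) · exp(iπ zᵀΩ^{−1}z) · Θ_{0,0}(z | Ω) for all z ∈ ℂ^r, where the square root is the branch positive on positive definite purely imaginary Ω. -/

import Mathlib

/-- The Riemann theta function `Θ_{0,0}(z|Ω) = Σ_{n∈ℤ^r} exp(2πi[(1/2)nᵀΩn + nᵀz])`. -/
noncomputable def theta00 {r : ℕ} (z : Fin r → ℂ) (Ω : Matrix (Fin r) (Fin r) ℂ) : ℂ :=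
  ∑' n : Fin r → ℤ, Complex.exp (2 * Real.pi * Complex.I *
    ((1 / 2) * ∑ i, ∑ j, (n i : ℂ) * Ω i j * (n j : ℂ) + ∑ i, (n i : ℂ) * z i))

open Complex in
lemma aux_summable_one (δ w : ℝ) (hδ : 0 < δ) :
    Summable (fun n : ℤ => Real.exp (-Real.pi * (δ * (n:ℝ)^2 + 2 * w * n))) := by
  have h := ((summable_jacobiTheta₂_term_iff ((w:ℂ) * I) ((δ:ℂ) * I)).mpr (by simpa using hδ)).norm
  refine h.congr fun n => ?_
  rw [norm_jacobiTheta₂_term]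
  congr 1
  simp
  ring

lemma aux_summable_prod (r : ℕ) (f : Fin r → ℤ → ℝ) (h0 : ∀ i n, 0 ≤ f i n)
    (hf : ∀ i, Summable (f i)) : Summable (fun n : Fin r → ℤ => ∏ i, f i (n i)) := by
  induction r with
  | zero => exact Summable.of_finite
  | succ r ih =>
    rw [← (Fin.consEquiv (fun _ : Fin (r+1) => ℤ)).summable_iff]
    have := (hf 0).mul_of_nonneg (ih (fun i => f i.succ) (fun i => h0 _) (fun i => hf _)) (h0 0)
      (fun n => Finset.prod_nonneg fun i _ => h0 _ _)
    refine this.congr fun n => ?_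
    simp [Fin.consEquiv, Fin.prod_univ_succ]

lemma aux_lower (r : ℕ) (Q : (Fin r → ℝ) → ℝ) (hc : Continuous Q)
    (hh : ∀ (t : ℝ) y, Q (t • y) = t ^ 2 * Q y) (hp : ∀ y, y ≠ 0 → 0 < Q y) :
    ∃ δ : ℝ, 0 < δ ∧ ∀ y, δ * ∑ i, y i ^ 2 ≤ Q y := by
  have hQ0 : Q 0 = 0 := by simpa using hh 0 0
  rcases Nat.eq_zero_or_pos r with rfl | hr
  · refine ⟨1, one_pos, fun y => ?_⟩
    rw [Subsingleton.elim y 0, hQ0]; simp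
  have : Nonempty (Fin r) := ⟨⟨0, hr⟩⟩
  obtain ⟨x, hx, hmin⟩ := (isCompact_sphere (0 : Fin r → ℝ) 1).exists_isMinOn
    ((NormedSpace.sphere_nonempty).2 zero_le_one) hc.continuousOn
  have hx1 : ‖x‖ = 1 := by simpa using hx
  have hx0 : x ≠ 0 := by rintro rfl; simp at hx1
  have hr' : (0:ℝ) < r := by exact_mod_cast hr
  refine ⟨Q x / r, div_pos (hp x hx0) hr', fun y => ?_⟩
  by_cases hy : y = 0
  · subst hy; simp [hQ0]
  have hny : 0 < ‖y‖ := norm_pos_iff.2 hy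
  have h1 : Q x ≤ Q (‖y‖⁻¹ • y) := hmin (by simp [norm_smul, hny.ne'])
  rw [hh, inv_pow, inv_mul_eq_div, le_div_iff₀ (by positivity)] at h1
  have h2 : ∑ i, y i ^ 2 ≤ r * ‖y‖ ^ 2 := by
    calc ∑ i, y i ^ 2 ≤ ∑ i : Fin r, ‖y‖ ^ 2 := by
          refine Finset.sum_le_sum fun i _ => ?_
          rw [← sq_abs]
          exact pow_le_pow_left₀ (abs_nonneg _) (norm_le_pi_norm y i) 2
      _ = _ := by simp
  calc Q x / r * ∑ i, y i ^ 2 ≤ Q x / r * (r * ‖y‖ ^ 2) :=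
        mul_le_mul_of_nonneg_left h2 (div_pos (hp x hx0) hr').le
    _ = Q x * ‖y‖ ^ 2 := by field_simp
    _ ≤ _ := h1

lemma aux_summable (r : ℕ) (Q : (Fin r → ℝ) → ℝ) (hc : Continuous Q)
    (hh : ∀ (t : ℝ) y, Q (t • y) = t ^ 2 * Q y) (hp : ∀ y, y ≠ 0 → 0 < Q y)
    (w : Fin r → ℝ) (C : ℝ) (E : (Fin r → ℤ) → ℂ)
    (hE : ∀ n, (E n).im = Q (fun i => (n i : ℝ)) + 2 * ∑ i, w i * n i + C) :
    Summable (fun n => Complex.exp (Real.pi * Complex.I * E n)) := by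
  obtain ⟨δ, hδ, hb⟩ := aux_lower r Q hc hh hp
  have hs := (aux_summable_prod r (fun i n => Real.exp (-Real.pi * (δ * (n:ℝ)^2 + 2 * w i * n)))
    (fun _ _ => (Real.exp_pos _).le) (fun i => aux_summable_one δ (w i) hδ)).mul_left
    (Real.exp (-Real.pi * C))
  refine Summable.of_norm_bounded hs fun n => ?_
  rw [Complex.norm_exp, ← Real.exp_sum, ← Real.exp_add, Real.exp_le_exp]
  have h1 : (Real.pi * Complex.I * E n).re = -Real.pi * (E n).im := by simp
  rw [h1, hE, ← Finset.mul_sum, ← mul_add]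
  refine mul_le_mul_of_nonpos_left ?_ (by linarith [Real.pi_pos])
  have h2 := hb (fun i => (n i : ℝ))
  rw [Finset.sum_add_distrib, ← Finset.mul_sum]
  simp_rw [mul_assoc]
  rw [← Finset.mul_sum]
  linarith

/-- quadratic form -/
noncomputable def qf {r : ℕ} (M : Matrix (Fin r) (Fin r) ℂ) (x : Fin r → ℂ) : ℂ :=
  ∑ i, ∑ j, x i * M i j * x j

/-- Schur complement -/
noncomputable def schur {r : ℕ} (M : Matrix (Fin (r+1)) (Fin (r+1)) ℂ) :
    Matrix (Fin r) (Fin r) ℂ :=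
  fun i j => M i.succ j.succ - M 0 i.succ * M 0 j.succ / M 0 0

lemma qf_succ {r : ℕ} (M : Matrix (Fin (r+1)) (Fin (r+1)) ℂ) (hM : M.IsSymm)
    (x : Fin (r+1) → ℂ) :
    qf M x = M 0 0 * x 0 ^ 2 + 2 * x 0 * ∑ i, M 0 (Fin.succ i) * x (Fin.succ i) +
      qf (M.submatrix Fin.succ Fin.succ) (fun i => x i.succ) := by
  have hs : ∀ i : Fin r, M i.succ 0 = M 0 i.succ := fun i => hM.apply _ _
  simp only [qf, Fin.sum_univ_succ, Finset.sum_add_distrib, Matrix.submatrix_apply, hs]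
  have h1 : ∑ i : Fin r, x 0 * M 0 i.succ * x i.succ = x 0 * ∑ i, M 0 (Fin.succ i) * x (Fin.succ i) := by
    rw [Finset.mul_sum]; exact Finset.sum_congr rfl fun i _ => by ring
  have h2 : ∑ i : Fin r, x i.succ * M 0 i.succ * x 0 = x 0 * ∑ i, M 0 (Fin.succ i) * x (Fin.succ i) := by
    rw [Finset.mul_sum]; exact Finset.sum_congr rfl fun i _ => by ring
  rw [h1, h2]; ring

lemma qf_schur {r : ℕ} (M : Matrix (Fin (r+1)) (Fin (r+1)) ℂ) (x : Fin r → ℂ) :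
    qf (schur M) x = qf (M.submatrix Fin.succ Fin.succ) x -
      (∑ i, M 0 (Fin.succ i) * x i) ^ 2 / M 0 0 := by
  simp only [qf, schur, Matrix.submatrix_apply, sq, Finset.sum_mul_sum, Finset.sum_div,
    ← Finset.sum_sub_distrib]
  refine Finset.sum_congr rfl fun i _ => Finset.sum_congr rfl fun j _ => by ring

lemma schur_symm {r : ℕ} (M : Matrix (Fin (r+1)) (Fin (r+1)) ℂ) (hM : M.IsSymm) :
    (schur M).IsSymm := by
  refine Matrix.IsSymm.ext fun i j => ?_
  simp only [schur, hM.apply i.succ j.succ]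
  ring

lemma det_schur {r : ℕ} (M : Matrix (Fin (r+1)) (Fin (r+1)) ℂ) (hM : M.IsSymm)
    (h0 : M 0 0 ≠ 0) : M.det = M 0 0 * (schur M).det := by
  have hs : ∀ i : Fin r, M i.succ 0 = M 0 i.succ := fun i => hM.apply _ _
  let B : Matrix (Fin (r+1)) (Fin (r+1)) ℂ := Matrix.of (fun i j => Fin.cases (M 0 j)
    (fun i' => M i'.succ j - M 0 i'.succ / M 0 0 * M 0 j) i)
  have hB0 : ∀ j, B 0 j = M 0 j := fun j => rfl
  have hBs : ∀ i j, B (Fin.succ i) j = M i.succ j - M 0 i.succ / M 0 0 * M 0 j := fun i j => rfl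
  have hdet : M.det = B.det := by
    refine Matrix.det_eq_of_forall_row_eq_smul_add_const
      (Fin.cons 0 (fun i' => M 0 (Fin.succ i') / M 0 0)) 0 rfl fun i j => ?_
    refine Fin.cases ?_ (fun i => ?_) i
    · simp [hB0]
    · simp [hB0, hBs]
  rw [hdet, Matrix.det_succ_column_zero, Fin.sum_univ_succ, Finset.sum_eq_zero]
  · simp only [Fin.val_zero, pow_zero, one_mul, add_zero, hB0]
    congr 2
    ext i j
    simp [schur, Matrix.submatrix_apply, hBs]
    ring
  · intro i _
    have : B i.succ 0 = 0 := by rw [hBs, hs]; field_simp; simp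
    rw [this]; ring

lemma inv_qf {r : ℕ} (M : Matrix (Fin (r+1)) (Fin (r+1)) ℂ) (hM : M.IsSymm)
    (h0 : M 0 0 ≠ 0) (hS : (schur M).det ≠ 0) (x : Fin (r+1) → ℂ) :
    qf M⁻¹ x = x 0 ^ 2 / M 0 0 +
      qf (schur M)⁻¹ (fun i => x i.succ - x 0 * M 0 i.succ / M 0 0) := by
  have hs : ∀ i : Fin r, M i.succ 0 = M 0 i.succ := fun i => hM.apply _ _
  have hq : ∀ {s : ℕ} (N : Matrix (Fin s) (Fin s) ℂ) (v : Fin s → ℂ),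
      qf N v = ∑ i, v i * N.mulVec v i := by
    intro s N v
    simp only [qf, Matrix.mulVec, dotProduct, Finset.mul_sum, mul_assoc]
  have hdet : IsUnit M.det := by
    rw [det_schur M hM h0]; exact (mul_ne_zero h0 hS).isUnit
  set u : Fin r → ℂ := fun i => x i.succ - x 0 * M 0 i.succ / M 0 0 with hu
  set y' : Fin r → ℂ := (schur M)⁻¹.mulVec u with hy'
  have hSy : (schur M).mulVec y' = u := by
    rw [hy', Matrix.mulVec_mulVec, Matrix.mul_nonsing_inv _ hS.isUnit, Matrix.one_mulVec]
  set B : ℂ := ∑ i, M 0 (Fin.succ i) * y' i with hB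
  set y : Fin (r+1) → ℂ := Fin.cons ((x 0 - B) / M 0 0) y' with hy
  have hMy : M.mulVec y = x := by
    ext i
    refine Fin.cases ?_ (fun i => ?_) i
    · simp only [Matrix.mulVec, dotProduct, Fin.sum_univ_succ, hy, Fin.cons_zero, Fin.cons_succ]
      rw [← hB]; field_simp; ring
    · have h1 := congrFun hSy i
      simp only [Matrix.mulVec, dotProduct, schur, hu, sub_mul, Finset.sum_sub_distrib] at h1
      have h2 : ∑ j, M 0 i.succ * M 0 (Fin.succ j) / M 0 0 * y' j = M 0 i.succ / M 0 0 * B := by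
        rw [hB, Finset.mul_sum]; exact Finset.sum_congr rfl fun j _ => by ring
      rw [h2] at h1
      simp only [Matrix.mulVec, dotProduct, Fin.sum_univ_succ, hy, Fin.cons_zero, Fin.cons_succ, hs]
      rw [sub_eq_iff_eq_add] at h1
      rw [h1]; ring
  have hinv : M⁻¹.mulVec x = y := by
    rw [← hMy, Matrix.mulVec_mulVec, Matrix.nonsing_inv_mul _ hdet, Matrix.one_mulVec]
  rw [hq, hq, hinv, ← hy', Fin.sum_univ_succ]
  simp only [hy, Fin.cons_zero, Fin.cons_succ, hu, sub_mul, Finset.sum_sub_distrib]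
  have h2 : ∑ j, x 0 * M 0 (Fin.succ j) / M 0 0 * y' j = x 0 / M 0 0 * B := by
    rw [hB, Finset.mul_sum]; exact Finset.sum_congr rfl fun j _ => by ring
  rw [h2]; ring

lemma aux_summable' (r : ℕ) (Q : (Fin r → ℝ) → ℂ) (hc : Continuous Q)
    (hh : ∀ (t : ℝ) y, Q (t • y) = t ^ 2 * Q y) (hp : ∀ y, y ≠ 0 → 0 < (Q y).im)
    (w : Fin r → ℂ) (C : ℂ) (E : (Fin r → ℤ) → ℂ)
    (hE : ∀ n, E n = Q (fun i => (n i : ℝ)) + 2 * ∑ i, w i * n i + C) :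
    Summable (fun n => Complex.exp (Real.pi * Complex.I * E n)) := by
  refine aux_summable r (fun y => (Q y).im) (Complex.continuous_im.comp hc) (fun t y => ?_) hp
    (fun i => (w i).im) C.im E fun n => ?_
  · simp only [hh, ← Complex.ofReal_pow, Complex.im_ofReal_mul]
  · rw [hE]
    simp

lemma qf_smul {r : ℕ} (M : Matrix (Fin r) (Fin r) ℂ) (t : ℂ) (x : Fin r → ℂ) :
    qf M (fun i => t * x i) = t ^ 2 * qf M x := by
  simp only [qf, Finset.mul_sum]
  refine Finset.sum_congr rfl fun i _ => Finset.sum_congr rfl fun j _ => by ring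

lemma qf_cont {r : ℕ} (M : Matrix (Fin r) (Fin r) ℂ) {X : Type*} [TopologicalSpace X]
    (f : X → Fin r → ℂ) (hf : ∀ i, Continuous (fun x => f x i)) :
    Continuous (fun x => qf M (f x)) := by
  unfold qf
  fun_prop

/-- positive definite imaginary part -/
def PD {r : ℕ} (M : Matrix (Fin r) (Fin r) ℂ) : Prop :=
  ∀ y : Fin r → ℝ, y ≠ 0 → 0 < (qf M (fun i => (y i : ℂ))).im

lemma summable_qf {r : ℕ} (M : Matrix (Fin r) (Fin r) ℂ) (hM : PD M) (w : Fin r → ℂ) (C : ℂ) 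
    (E : (Fin r → ℤ) → ℂ) (hE : ∀ n, E n = qf M (fun i => (n i : ℂ)) + 2 * ∑ i, w i * n i + C) :
    Summable (fun n => Complex.exp (Real.pi * Complex.I * E n)) := by
  refine aux_summable' r (fun y => qf M (fun i => (y i : ℂ))) (qf_cont _ _ (by fun_prop))
    (fun t y => ?_) hM w C E fun n => ?_
  · rw [← qf_smul]; simp
  · rw [hE]; simp

/-- partially transformed quadratic form -/
noncomputable def mixed {r : ℕ} (M : Matrix (Fin (r+1)) (Fin (r+1)) ℂ) (y : Fin (r+1) → ℝ) : ℂ :=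
  qf (M.submatrix Fin.succ Fin.succ) (fun i => (y i.succ : ℂ)) -
    (y 0 - ∑ i, M 0 (Fin.succ i) * y (Fin.succ i)) ^ 2 / M 0 0

lemma PD.zero_zero {r : ℕ} {M : Matrix (Fin (r+1)) (Fin (r+1)) ℂ} (h : PD M) (hM : M.IsSymm) :
    0 < (M 0 0).im := by
  have := h (Fin.cons 1 0) (fun h => by simpa using congrFun h 0)
  rw [qf_succ _ hM] at this
  simpa [qf] using this

lemma PD.mixed_pos {r : ℕ} {M : Matrix (Fin (r+1)) (Fin (r+1)) ℂ} (h : PD M) (hM : M.IsSymm)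
    (y : Fin (r+1) → ℝ) (hy : y ≠ 0) : 0 < (mixed M y).im := by
  have hv := h.zero_zero hM
  have hN : 0 < Complex.normSq (M 0 0) := Complex.normSq_pos.2 (by intro h; simp [h] at hv)
  unfold mixed
  by_cases h0 : ∀ i : Fin r, y i.succ = 0
  · have hy0 : y 0 ≠ 0 := by
      intro h1
      apply hy
      ext i
      exact Fin.cases h1 h0 i
    have : (-((y 0 : ℂ) ^ 2 / M 0 0)).im = y 0 ^ 2 * (M 0 0).im / Complex.normSq (M 0 0) := by
      rw [div_eq_mul_inv, ← Complex.ofReal_pow, Complex.neg_im, Complex.im_ofReal_mul,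
        Complex.inv_im]
      ring
    simp only [h0, qf, Complex.ofReal_zero, mul_zero, Finset.sum_const_zero, sub_zero, zero_sub]
    rw [this]
    positivity
  · set b : ℂ := ∑ i, M 0 (Fin.succ i) * y (Fin.succ i) with hb
    set A : ℂ := qf (M.submatrix Fin.succ Fin.succ) (fun i => (y i.succ : ℂ)) with hA
    have h1 := h (Fin.cons (-b.im / (M 0 0).im) (fun i => y i.succ)) (fun h => h0 fun i => by
      simpa using congrFun h i.succ)
    rw [qf_succ _ hM] at h1
    simp only [Fin.cons_zero, Fin.cons_succ, ← hb, ← hA] at h1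
    set v := (M 0 0).im with hvd
    set u := (M 0 0).re with hud
    have h2 : 0 < A.im - b.im ^ 2 / v := by
      have e : (M 0 0 * ((-b.im / v : ℝ) : ℂ) ^ 2 + 2 * ((-b.im / v : ℝ) : ℂ) * b + A).im =
        A.im - b.im ^ 2 / v := by
        have e1 : (2 * ((-b.im / v : ℝ) : ℂ) * b) = ((2 * (-b.im / v) : ℝ) : ℂ) * b := by
          push_cast; ring
        rw [e1, ← Complex.ofReal_pow, Complex.add_im, Complex.add_im, Complex.im_mul_ofReal,
          Complex.im_ofReal_mul, ← hvd]
        field_simp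
        ring
      rwa [e] at h1
    have e2 : (A - ((y 0 : ℂ) - b) ^ 2 / M 0 0).im = (A.im - b.im ^ 2 / v) +
        (b.im * u + v * (y 0 - b.re)) ^ 2 / (v * (u ^ 2 + v ^ 2)) := by
      have : Complex.normSq (M 0 0) = u ^ 2 + v ^ 2 := by rw [Complex.normSq_apply]; ring
      rw [Complex.sub_im, Complex.div_im, this, ← hvd, ← hud]
      have hpos : u ^ 2 + v ^ 2 ≠ 0 := by rw [← this]; exact hN.ne'
      simp only [sq, Complex.mul_re, Complex.mul_im, Complex.sub_re, Complex.sub_im,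
        Complex.ofReal_re, Complex.ofReal_im] at hpos ⊢
      field_simp
      ring
    rw [e2]
    have : 0 ≤ (b.im * u + v * (y 0 - b.re)) ^ 2 / (v * (u ^ 2 + v ^ 2)) := by positivity
    linarith

lemma PD.schur {r : ℕ} {M : Matrix (Fin (r+1)) (Fin (r+1)) ℂ} (h : PD M) (hM : M.IsSymm) :
    PD (schur M) := by
  intro y hy
  have := h.mixed_pos hM (Fin.cons 0 y) (fun h => hy (by
    ext i; simpa using congrFun h i.succ))
  rw [qf_schur]
  simpa [mixed] using this

lemma PD.neg_inv {r : ℕ} {M : Matrix (Fin r) (Fin r) ℂ} (h : PD M) (hM : M.IsSymm)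
    (hd : M.det ≠ 0) : PD (-M⁻¹) := by
  intro y hy
  set u : Fin r → ℂ := M⁻¹.mulVec (fun i => (y i : ℂ)) with hu
  have hMu : M.mulVec u = (fun i => (y i : ℂ)) := by
    rw [hu, Matrix.mulVec_mulVec, Matrix.mul_nonsing_inv _ hd.isUnit, Matrix.one_mulVec]
  have h1 : qf (-M⁻¹) (fun i => (y i : ℂ)) = - ∑ i, (y i : ℂ) * u i := by
    simp only [hu, qf, Matrix.mulVec, dotProduct, Finset.mul_sum, mul_assoc, Matrix.neg_apply,
      neg_mul, mul_neg, Finset.sum_neg_distrib]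
  have h2 : (- ∑ i, (y i : ℂ) * u i).im = (∑ i, (starRingEnd ℂ) (u i) * (y i : ℂ)).im := by
    simp [mul_comm]
  have h3 : ∑ i, (starRingEnd ℂ) (u i) * (y i : ℂ) =
      ∑ i, ∑ j, (starRingEnd ℂ) (u i) * M i j * u j := by
    refine Finset.sum_congr rfl fun i _ => ?_
    rw [← congrFun hMu i]
    simp only [Matrix.mulVec, dotProduct, Finset.mul_sum, mul_assoc]
  have h4 : (∑ i, ∑ j, (starRingEnd ℂ) (u i) * M i j * u j).im =
      (qf M (fun i => ((u i).re : ℂ))).im + (qf M (fun i => ((u i).im : ℂ))).im := by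
    have e0 : ∑ i, ∑ j, (M i j).re * ((u i).re * (u j).im - (u i).im * (u j).re) = 0 := by
      simp only [mul_sub, Finset.sum_sub_distrib]
      rw [sub_eq_zero, Finset.sum_comm]
      refine Finset.sum_congr rfl fun i _ => Finset.sum_congr rfl fun j _ => ?_
      rw [hM.apply i j]; ring
    rw [← add_zero ((qf M _).im + _), ← e0]
    simp only [qf, Complex.im_sum, ← Finset.sum_add_distrib]
    refine Finset.sum_congr rfl fun i _ => Finset.sum_congr rfl fun j _ => ?_
    simp
    ring
  rw [h1, h2, h3, h4]
  have hnn : ∀ t : Fin r → ℝ, 0 ≤ (qf M (fun i => (t i : ℂ))).im := by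
    intro t
    by_cases ht : t = 0
    · subst ht; simp [qf]
    · exact (h t ht).le
  by_cases hre : (fun i => (u i).re) = 0
  · have him : (fun i => (u i).im) ≠ 0 := by
      intro him
      have : u = 0 := by
        ext i
        exact Complex.ext (congrFun hre i) (congrFun him i)
      rw [this, Matrix.mulVec_zero] at hMu
      apply hy
      ext i
      simpa using (congrFun hMu i).symm
    exact add_pos_of_nonneg_of_pos (hnn fun i => (u i).re) (h (fun i => (u i).im) him)
  · exact add_pos_of_pos_of_nonneg (h (fun i => (u i).re) hre) (hnn fun i => (u i).im)

open Complex in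
lemma poisson_one (τ : ℂ) (hτ : 0 < τ.im) (z : ℂ) :
    (-I * τ) ^ (1 / 2 : ℂ) * ∑' k : ℤ, cexp (Real.pi * I * (τ * k ^ 2 + 2 * k * z)) =
      ∑' k : ℤ, cexp (Real.pi * I * (-(z - k) ^ 2 / τ)) := by
  have hτ0 : τ ≠ 0 := by rintro rfl; simp at hτ
  have h := jacobiTheta₂_functional_equation z τ
  have hc : (-I * τ) ^ (1 / 2 : ℂ) ≠ 0 := by
    rw [Ne, cpow_eq_zero_iff]; simp [hτ0]
  have h1 : ∑' k : ℤ, cexp (Real.pi * I * (τ * k ^ 2 + 2 * k * z)) = jacobiTheta₂ z τ := by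
    unfold jacobiTheta₂ jacobiTheta₂_term
    refine tsum_congr fun k => ?_
    congr 1; ring
  rw [h1, h, ← mul_assoc, ← mul_assoc, mul_one_div_cancel hc, one_mul]
  unfold jacobiTheta₂ jacobiTheta₂_term
  rw [← tsum_mul_left]
  refine tsum_congr fun k => ?_
  rw [← Complex.exp_add]
  congr 1
  field_simp
  ring

lemma qf_sub {r : ℕ} (W : Matrix (Fin r) (Fin r) ℂ) (hW : W.IsSymm) (z x : Fin r → ℂ) :
    qf W (fun i => z i - x i) = qf W z - 2 * ∑ i, W.mulVec z i * x i + qf W x := by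
  have h1 : ∑ i, W.mulVec z i * x i = ∑ i, ∑ j, x i * W i j * z j := by
    simp only [Matrix.mulVec, dotProduct, Finset.sum_mul]
    refine Finset.sum_congr rfl fun i _ => Finset.sum_congr rfl fun j _ => by ring
  have h2 : ∑ i, W.mulVec z i * x i = ∑ i, ∑ j, z i * W i j * x j := by
    rw [h1, Finset.sum_comm]
    refine Finset.sum_congr rfl fun i _ => Finset.sum_congr rfl fun j _ => ?_
    rw [hW.apply i j]; ring
  rw [two_mul]
  nth_rewrite 1 [h1]
  rw [h2]
  simp only [qf, ← Finset.sum_add_distrib, ← Finset.sum_sub_distrib]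
  refine Finset.sum_congr rfl fun i _ => Finset.sum_congr rfl fun j _ => by ring

lemma qf_neg {r : ℕ} (W : Matrix (Fin r) (Fin r) ℂ) (x : Fin r → ℂ) :
    qf (-W) x = - qf W x := by
  simp [qf]

lemma mixed_smul {r : ℕ} (M : Matrix (Fin (r+1)) (Fin (r+1)) ℂ) (t : ℝ) (y : Fin (r+1) → ℝ) :
    mixed M (t • y) = t ^ 2 * mixed M y := by
  have h1 : ∑ i : Fin r, M 0 i.succ * ((t : ℂ) * y i.succ) = t * ∑ i : Fin r, M 0 i.succ * y i.succ := by
    rw [Finset.mul_sum]; exact Finset.sum_congr rfl fun i _ => by ring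
  simp only [mixed, Pi.smul_apply, smul_eq_mul, Complex.ofReal_mul]
  rw [qf_smul, h1]; ring

open Complex in
theorem poisson (r : ℕ) (Ω : Matrix (Fin r) (Fin r) ℂ) (hΩ : Ω.IsSymm) (hP : PD Ω) :
    ∃ c : ℂ, c ^ 2 = Matrix.det ((-I) • Ω) ∧ Ω.det ≠ 0 ∧
      ((∀ i j, (Ω i j).re = 0) → 0 < c.re ∧ c.im = 0) ∧
      ∀ z : Fin r → ℂ,
        c * ∑' n : Fin r → ℤ, cexp (Real.pi * I * (qf Ω (fun i => n i) + 2 * ∑ i, z i * n i)) =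
        ∑' n : Fin r → ℤ, cexp (Real.pi * I * (-qf Ω⁻¹ (fun i => z i - n i))) := by
  induction r with
  | zero =>
    refine ⟨1, by simp, by simp, by simp, fun z => ?_⟩
    simp [qf]
  | succ r ih =>
    have hω := hP.zero_zero hΩ
    have hω0 : Ω 0 0 ≠ 0 := by intro h; simp [h] at hω
    obtain ⟨c', hc2, hS, hre, hz⟩ := ih (schur Ω) (schur_symm Ω hΩ) (hP.schur hΩ)
    have hdet : Ω.det ≠ 0 := by rw [det_schur Ω hΩ hω0]; exact mul_ne_zero hω0 hS
    set c0 : ℂ := (-I * Ω 0 0) ^ (1 / 2 : ℂ) with hc0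
    refine ⟨c0 * c', ?_, hdet, ?_, ?_⟩
    · have h1 : c0 ^ 2 = -I * Ω 0 0 := by
        rw [hc0, one_div]
        exact Complex.cpow_nat_inv_pow _ two_ne_zero
      rw [mul_pow, h1, hc2, Matrix.det_smul, Matrix.det_smul, det_schur Ω hΩ hω0]
      simp only [Fintype.card_fin, pow_succ]
      ring
    · intro h
      have hΩi : ∀ i j, Ω i j = ((Ω i j).im : ℂ) * I := fun i j => by
        apply Complex.ext <;> simp [h]
      obtain ⟨h1, h2⟩ := hre (fun i j => by
        have : schur Ω i j = (((Ω i.succ j.succ).im -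
            (Ω 0 i.succ).im * (Ω 0 j.succ).im / (Ω 0 0).im : ℝ) : ℂ) * I := by
          have hv : ((Ω 0 0).im : ℂ) ≠ 0 := by exact_mod_cast hω.ne'
          simp only [schur]
          rw [hΩi i.succ j.succ, hΩi 0 i.succ, hΩi 0 j.succ, hΩi 0 0]
          push_cast
          simp only [Complex.mul_im, Complex.ofReal_im, Complex.ofReal_re, Complex.I_im,
            Complex.I_re, mul_one, mul_zero, zero_mul, add_zero]
          field_simp
        rw [this]; simp)
      have h3 : c0 = (((Ω 0 0).im ^ (1 / 2 : ℝ) : ℝ) : ℂ) := by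
        rw [hc0, Complex.ofReal_cpow hω.le, hΩi 0 0]
        congr 1
        · simp only [Complex.mul_im, Complex.ofReal_im, Complex.ofReal_re, Complex.I_im,
            Complex.I_re, mul_one, mul_zero, zero_mul, add_zero]
          linear_combination (-((Ω 0 0).im : ℂ)) * Complex.I_mul_I
        · simp
      rw [h3, Complex.re_ofReal_mul, Complex.im_ofReal_mul, h2]
      exact ⟨mul_pos (Real.rpow_pos_of_pos hω _) h1, mul_zero _⟩
    · intro z
      set e := Fin.consEquiv (fun _ : Fin (r+1) => ℤ) with he
      have he0 : ∀ p, e p 0 = p.1 := fun p => rfl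
      have hes : ∀ p i, e p (Fin.succ i) = p.2 i := fun p i => rfl
      set F1 : (Fin (r+1) → ℤ) → ℂ := fun n =>
        cexp (Real.pi * I * (qf Ω (fun i => n i) + 2 * ∑ i, z i * n i)) with hF1
      set F3 : (Fin (r+1) → ℤ) → ℂ := fun n =>
        cexp (Real.pi * I * (-qf Ω⁻¹ (fun i => z i - n i))) with hF3
      set F2 : (Fin (r+1) → ℤ) → ℂ := fun n =>
        cexp (Real.pi * I * (qf (Ω.submatrix Fin.succ Fin.succ) (fun i => (n i.succ : ℂ)) +
          2 * ∑ i : Fin r, z i.succ * n i.succ -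
          (z 0 + ∑ i : Fin r, Ω 0 i.succ * n i.succ - n 0) ^ 2 / Ω 0 0)) with hF2
      have S1 : Summable F1 := summable_qf Ω hP z 0 _ fun n => by ring
      have hWs : (Ω⁻¹).IsSymm := by
        rw [Matrix.IsSymm, Matrix.transpose_nonsing_inv, hΩ.eq]
      have S3 : Summable F3 := by
        refine summable_qf (-Ω⁻¹) (hP.neg_inv hΩ hdet) (Ω⁻¹.mulVec z) (-qf Ω⁻¹ z) _ fun n => ?_
        rw [qf_sub _ hWs, qf_neg]; ring
      have S2 : Summable F2 := by
        refine aux_summable' (r+1) (mixed Ω) ?_ (mixed_smul Ω) (hP.mixed_pos hΩ)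
          (Fin.cons (z 0 / Ω 0 0) (fun i => z i.succ - z 0 * Ω 0 i.succ / Ω 0 0))
          (-(z 0 ^ 2 / Ω 0 0)) _ fun n => ?_
        · unfold mixed
          refine Continuous.sub (qf_cont _ _ (by fun_prop)) (by fun_prop)
        · simp only [mixed, Fin.sum_univ_succ, Fin.cons_zero, Fin.cons_succ, sub_mul,
            Finset.sum_sub_distrib, Complex.ofReal_intCast]
          have : ∑ i : Fin r, z 0 * Ω 0 i.succ / Ω 0 0 * (n i.succ : ℂ) =
              z 0 / Ω 0 0 * ∑ i : Fin r, Ω 0 i.succ * n i.succ := by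
            rw [Finset.mul_sum]; exact Finset.sum_congr rfl fun i _ => by ring
          rw [this]; ring
      have T1 := e.summable_iff.2 S1
      have T2 := e.summable_iff.2 S2
      have T3 := e.summable_iff.2 S3
      have step1 : c0 * ∑' n, F1 n = ∑' m : Fin r → ℤ, ∑' k : ℤ, F2 (e (k, m)) := by
        rw [← e.tsum_eq F1, ← (Equiv.prodComm _ _).tsum_eq (fun p => F1 (e p)),
          Summable.tsum_prod (f := fun p => F1 (e (Equiv.prodComm _ _ p)))
            ((Equiv.prodComm _ _).summable_iff.2 T1), ← tsum_mul_left]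
        refine tsum_congr fun m => ?_
        have key := poisson_one (Ω 0 0) hω (z 0 + ∑ i : Fin r, Ω 0 i.succ * m i)
        have a1 : ∀ k : ℤ, F1 (e (k, m)) =
            cexp (Real.pi * I * (qf (Ω.submatrix Fin.succ Fin.succ) (fun i => (m i : ℂ)) +
              2 * ∑ i : Fin r, z i.succ * m i)) *
            cexp (Real.pi * I * (Ω 0 0 * k ^ 2 + 2 * k * (z 0 + ∑ i : Fin r, Ω 0 i.succ * m i))) := by
          intro k
          simp only [hF1]
          rw [← Complex.exp_add, qf_succ _ hΩ]
          simp only [Fin.sum_univ_succ, he0, hes]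
          congr 1; ring
        have a2 : ∀ k : ℤ, F2 (e (k, m)) =
            cexp (Real.pi * I * (qf (Ω.submatrix Fin.succ Fin.succ) (fun i => (m i : ℂ)) +
              2 * ∑ i : Fin r, z i.succ * m i)) *
            cexp (Real.pi * I * (-((z 0 + ∑ i : Fin r, Ω 0 i.succ * m i) - k) ^ 2 / Ω 0 0)) := by
          intro k
          simp only [hF2]
          rw [← Complex.exp_add]
          simp only [he0, hes]
          congr 1; ring
        simp only [Equiv.prodComm_apply, Prod.swap_prod_mk, a1, a2, tsum_mul_left]
        rw [← key]; ring
      have step2 : ∀ k : ℤ, c' * ∑' m : Fin r → ℤ, F2 (e (k, m)) =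
          ∑' m : Fin r → ℤ, F3 (e (k, m)) := by
        intro k
        have key := hz (fun i => z i.succ - (z 0 - k) * Ω 0 i.succ / Ω 0 0)
        have a2 : ∀ m : Fin r → ℤ, F2 (e (k, m)) =
            cexp (Real.pi * I * (-(z 0 - k) ^ 2 / Ω 0 0)) *
            cexp (Real.pi * I * (qf (schur Ω) (fun i => m i) +
              2 * ∑ i : Fin r, (z i.succ - (z 0 - k) * Ω 0 i.succ / Ω 0 0) * m i)) := by
          intro m
          simp only [hF2]
          rw [← Complex.exp_add, qf_schur]
          simp only [he0, hes, sub_mul _ _ ((_ : ℤ) : ℂ), Finset.sum_sub_distrib]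
          have : ∑ i : Fin r, (z 0 - k) * Ω 0 i.succ / Ω 0 0 * (m i : ℂ) =
              (z 0 - k) / Ω 0 0 * ∑ i : Fin r, Ω 0 i.succ * m i := by
            rw [Finset.mul_sum]; exact Finset.sum_congr rfl fun i _ => by ring
          rw [this]
          congr 1; ring
        have a3 : ∀ m : Fin r → ℤ, F3 (e (k, m)) =
            cexp (Real.pi * I * (-(z 0 - k) ^ 2 / Ω 0 0)) *
            cexp (Real.pi * I * (-qf (schur Ω)⁻¹ (fun i =>
              (z i.succ - (z 0 - k) * Ω 0 i.succ / Ω 0 0) - m i))) := by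
          intro m
          simp only [hF3]
          rw [← Complex.exp_add, inv_qf Ω hΩ hω0 hS]
          simp only [he0, hes]
          have : (fun i : Fin r => z i.succ - (m i : ℂ) - (z 0 - k) * Ω 0 i.succ / Ω 0 0) =
            (fun i : Fin r => (z i.succ - (z 0 - k) * Ω 0 i.succ / Ω 0 0) - m i) := by
            ext i; ring
          rw [this]
          congr 1; ring
        simp only [a2, a3, tsum_mul_left]
        rw [← key]; ring
      have hcomm : ∑' m : Fin r → ℤ, ∑' k : ℤ, F2 (e (k, m)) =
          ∑' k : ℤ, ∑' m : Fin r → ℤ, F2 (e (k, m)) :=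
        Summable.tsum_comm (f := fun k m => F2 (e (k, m))) T2
      rw [mul_comm c0, mul_assoc, step1, hcomm, ← tsum_mul_left, ← e.tsum_eq F3,
        Summable.tsum_prod (f := fun p => F3 (e p)) T3]
      exact tsum_congr step2

/-- the modular-type identity
`Θ_{0,0}(Ω⁻¹z | −Ω⁻¹) = √(det(−iΩ)) exp(iπ zᵀΩ⁻¹z) Θ_{0,0}(z | Ω)` for all `z ∈ ℂ^r`,
the square root being the branch which is positive when `Ω` is purely imaginary
(with positive definite imaginary part). -/
theorem stmt16 (r : ℕ) (Ω : Matrix (Fin r) (Fin r) ℂ) (hΩ : Ω.IsSymm)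
    (hIm : ∀ y : Fin r → ℝ, y ≠ 0 → 0 < ∑ i, ∑ j, y i * (Ω i j).im * y j) :
    ∃ c : ℂ, c ^ 2 = Matrix.det ((-Complex.I) • Ω) ∧
      ((∀ i j, (Ω i j).re = 0) → 0 < c.re ∧ c.im = 0) ∧
      ∀ z : Fin r → ℂ,
        theta00 (Ω⁻¹.mulVec z) (-(Ω⁻¹))
          = c * Complex.exp (Real.pi * Complex.I * ∑ i, ∑ j, z i * Ω⁻¹ i j * z j) *
              theta00 z Ω := by
  have hP : PD Ω := by
    intro y hy
    have := hIm y hy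
    simpa [qf] using this
  obtain ⟨c, h1, _, h2, h3⟩ := poisson r Ω hΩ hP
  refine ⟨c, h1, h2, fun z => ?_⟩
  have hWs : (Ω⁻¹).IsSymm := by
    rw [Matrix.IsSymm, Matrix.transpose_nonsing_inv, hΩ.eq]
  have e1 : theta00 z Ω = ∑' n : Fin r → ℤ, Complex.exp (Real.pi * Complex.I *
      (qf Ω (fun i => n i) + 2 * ∑ i, z i * n i)) := by
    unfold theta00
    refine tsum_congr fun n => ?_
    simp only [qf, mul_comm (z _)]
    congr 1; ring
  have e2 : theta00 (Ω⁻¹.mulVec z) (-(Ω⁻¹)) = Complex.exp (Real.pi * Complex.I * qf Ω⁻¹ z) *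
      ∑' n : Fin r → ℤ, Complex.exp (Real.pi * Complex.I * (-qf Ω⁻¹ (fun i => z i - n i))) := by
    unfold theta00
    rw [← tsum_mul_left]
    refine tsum_congr fun n => ?_
    rw [← Complex.exp_add, qf_sub _ hWs]
    have := qf_neg Ω⁻¹ (fun i => (n i : ℂ))
    rw [show ∑ i, ∑ j, (n i : ℂ) * (-Ω⁻¹) i j * (n j : ℂ) = _ from this]
    simp only [mul_comm (Matrix.mulVec _ _ _)]
    congr 1; ring
  rw [e2, ← h3, e1]
  simp only [qf]
  ring
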